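/- arXiv:2509.12703 — 3 statements merged into one kernel-verified Lean document; each statement's English description precedes it below -/
import Mathlib

section
/- For every integer k ≥ 2, the real number λ₊ = 2^k(2^{k+1}+1 + √(2^{k+4}−7)) / (2(2^k+1)) satisfies λ₊ ≤ 2^k + √(5·2^k). -/
/-- For every integer `k ≥ 2`, the larger eigenvalue
`λ₊ = 2^k(2^{k+1}+1 + √(2^{k+4}−7)) / (2(2^k+1))` satisfies `λ₊ ≤ 2^k + √(5·2^k)`. -/
theorem lambda_plus_le (k : ℕ) (hk : 2 ≤ k) (lp : ℝ)
    (hlp : lp = 2^k*(2^(k+1)+1 + Real.sqrt (2^(k+4)-7)) / (2*(2^k+1))) :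
    lp ≤ 2^k + Real.sqrt (5 * 2^k) := by
  have hq : (0 : ℝ) < 2 ^ k := by positivity
  have hr := Real.sqrt_nonneg (5 * 2 ^ k : ℝ)
  have ht : Real.sqrt (2 ^ (k + 4) - 7) ≤ 2 * Real.sqrt (5 * 2 ^ k) := by
    refine Real.sqrt_le_iff.mpr ⟨by positivity, ?_⟩
    rw [mul_pow, Real.sq_sqrt (by positivity), pow_add]
    linarith
  rw [hlp, div_le_iff₀ (by positivity), pow_succ]
  nlinarith [mul_le_mul_of_nonneg_left ht hq.le]
end

section
/- Let k ≥ 1 be an integer and set z = 2^k. Then the real number μ₊ = (z+1+√(z²+6z+1)) / (2(z+1)²) is positive and satisfies 1/μ₊ ≤ z + 3/(z+1). -/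
/-- For `z = 2^k` with `k ≥ 1`, the larger eigenvalue
`μ₊ = (z+1+√(z²+6z+1)) / (2(z+1)²)` of the transfer matrix `K₁` is positive and
satisfies `1/μ₊ ≤ z + 3/(z+1)`. -/
theorem mu_plus_pos_and_inv_le (k : ℕ) (hk : 1 ≤ k) (z : ℝ) (hz : z = 2^k)
    (μp : ℝ) (hμp : μp = (z+1 + Real.sqrt (z^2+6*z+1)) / (2*(z+1)^2)) :
    0 < μp ∧ 1/μp ≤ z + 3/(z+1) := by
  have hz0 : 0 < z := by rw [hz]; positivity
  have hq : 0 < z ^ 2 + z + 3 := by positivity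
  have hs : (z + 1) * (z ^ 2 + 3 * z - 1) / (z ^ 2 + z + 3) ≤ Real.sqrt (z ^ 2 + 6 * z + 1) := by
    apply Real.le_sqrt_of_sq_le
    rw [div_pow, div_le_iff₀ (by positivity)]
    have hpos : 0 ≤ 36 * z ^ 3 + 56 * z ^ 2 + 64 * z + 8 := by positivity
    linear_combination hpos
  rw [div_le_iff₀ hq] at hs
  subst hμp
  refine ⟨by positivity, ?_⟩
  have hr : z + 3 / (z + 1) = (z ^ 2 + z + 3) / (z + 1) := by field_simp
  rw [one_div_div, hr, div_le_div_iff₀ (by positivity) (by positivity)]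
  linear_combination hs
end

section
/- Let k and n be positive integers with k dividing n and k·2^k ≥ n. Then 2^n · (4^k + 2^k − 1)^{n/k} ≤ e · 8^n. -/
/-- For positive integers `k ∣ n` with `k·2^k ≥ n`,
`2^n · (4^k + 2^k − 1)^{n/k} ≤ e · 8^n`; this yields the optimal sample complexity
`T = O(8^n/ε²) = O(d³/ε²)` in the paper's Theorem 2. -/
theorem sample_count_bound (k n : ℕ) (hk : 0 < k) (hn : 0 < n) (hdvd : k ∣ n)
    (hkn : n ≤ k * 2^k) :
    (2^n : ℝ) * (4^k + 2^k - 1 : ℝ) ^ (n/k) ≤ Real.exp 1 * 8^n := by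
  obtain ⟨m, rfl⟩ := hdvd
  rw [Nat.mul_div_cancel_left m hk]
  have hm : (m : ℝ) ≤ 2 ^ k := by exact_mod_cast Nat.le_of_mul_le_mul_left hkn hk
  have hx : (1 : ℝ) ≤ 2 ^ k := one_le_pow₀ (by norm_num)
  have hx0 : (0 : ℝ) < 2 ^ k := by positivity
  have h4 : (4 : ℝ) ^ k = 2 ^ k * 2 ^ k := by rw [← mul_pow]; norm_num
  have h4pos : (0 : ℝ) < 4 ^ k := by positivity
  have hbase : (4 ^ k + 2 ^ k - 1 : ℝ) ≤ 4 ^ k * Real.exp (1 / 2 ^ k) := by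
    calc (4 ^ k + 2 ^ k - 1 : ℝ) ≤ 4 ^ k * (1 / 2 ^ k + 1) := by
          have : (4 : ℝ) ^ k * (1 / 2 ^ k + 1) = 2 ^ k + 4 ^ k := by
            rw [h4]; field_simp
          linarith
      _ ≤ 4 ^ k * Real.exp (1 / 2 ^ k) := by
          gcongr
          exact Real.add_one_le_exp _
  have hexp : Real.exp (1 / 2 ^ k) ^ m ≤ Real.exp 1 := by
    rw [← Real.exp_nat_mul, Real.exp_le_exp, mul_one_div]
    exact (div_le_one hx0).2 hm
  have h8 : (8 : ℝ) ^ (k * m) = 2 ^ (k * m) * 4 ^ (k * m) := by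
    rw [← mul_pow]; norm_num
  calc (2 ^ (k * m) : ℝ) * (4 ^ k + 2 ^ k - 1 : ℝ) ^ m
      ≤ 2 ^ (k * m) * (4 ^ k * Real.exp (1 / 2 ^ k)) ^ m := by
        have : (0 : ℝ) ≤ 4 ^ k + 2 ^ k - 1 := by linarith
        gcongr
    _ = Real.exp (1 / 2 ^ k) ^ m * 8 ^ (k * m) := by
        rw [mul_pow, ← pow_mul, h8]; ring
    _ ≤ Real.exp 1 * 8 ^ (k * m) := by gcongr
end
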